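/- Let p ≥ 2, t, h > 0, and fix u ≥ 0. Then the function Φ(v) = |u − v|^{p−2}(G_{t,h}(u) − G_{t,h}(v)) is nonincreasing on [0,∞): for every 0 ≤ v₁ ≤ v₂ one has |u − v₁|^{p−2}(G_{t,h}(u) − G_{t,h}(v₁)) ≥ |u − v₂|^{p−2}(G_{t,h}(u) − G_{t,h}(v₂)). -/

import Mathlib

open MeasureTheory Real Set
open scoped ENNReal NNReal

noncomputable section

/-- Euclidean space `ℝ^N`. -/
abbrev Euc (N : ℕ) := EuclideanSpace ℝ (Fin N)

/-- The truncation `G_{t,h}`: `0` for `θ ≤ t`, `θ - t` for `t < θ ≤ t+h`, `h` for `θ > t+h`. -/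
def trunc (t h θ : ℝ) : ℝ := if θ ≤ t then 0 else if θ ≤ t + h then θ - t else h

theorem trunc_mono {t h : ℝ} (hh : 0 < h) : Monotone (trunc t h) := by
  intro a b hab
  unfold trunc
  split_ifs <;> linarith

/-- For fixed `u ≥ 0`, the function `Φ(v) = |u - v|^{p-2}(G_{t,h}(u) - G_{t,h}(v))` is
nonincreasing on `[0,∞)` (here `|u-v|^{p-2}` is the real power, so for `p = 2` it equals `1`
also at `u = v`). -/
theorem Phi_antitone (p t h : ℝ) (hp : 2 ≤ p) (ht : 0 < t) (hh : 0 < h)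
    (u : ℝ) (hu : 0 ≤ u) (v₁ v₂ : ℝ) (hv₁ : 0 ≤ v₁) (hv : v₁ ≤ v₂) :
    |u - v₂| ^ (p - 2) * (trunc t h u - trunc t h v₂) ≤
      |u - v₁| ^ (p - 2) * (trunc t h u - trunc t h v₁) := by
  have hp' : 0 ≤ p - 2 := by linarith
  have hG := trunc_mono (t := t) hh
  have h12 := hG hv
  have pow_nonneg (x : ℝ) : 0 ≤ |x| ^ (p - 2) := rpow_nonneg (abs_nonneg x) _
  rcases le_total u v₁ with h1 | h1
  · have key : |u - v₁| ^ (p - 2) ≤ |u - v₂| ^ (p - 2) := by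
      refine rpow_le_rpow (abs_nonneg _) ?_ hp'
      rw [abs_of_nonpos (by linarith), abs_of_nonpos (by linarith)]
      linarith
    have := mul_le_mul key (show trunc t h v₁ - trunc t h u ≤ trunc t h v₂ - trunc t h u by
      linarith) (sub_nonneg.2 (hG h1)) (pow_nonneg _)
    linarith
  · rcases le_total u v₂ with h2 | h2
    · exact (mul_nonpos_of_nonneg_of_nonpos (pow_nonneg _) (sub_nonpos.2 (hG h2))).trans
        (mul_nonneg (pow_nonneg _) (sub_nonneg.2 (hG h1)))
    · refine mul_le_mul ?_ (by linarith) (sub_nonneg.2 (hG h2)) (pow_nonneg _)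
      refine rpow_le_rpow (abs_nonneg _) ?_ hp'
      rw [abs_of_nonneg (by linarith), abs_of_nonneg (by linarith)]
      linarith
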